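/- Let p be an odd prime, γ ≥ 2, u an integer with 1 ≤ u ≤ 4γ/5, and let s₁, s₂, t₁, t₂, λ₁, λ₂, m be integers with gcd(s₁s₂λ₁λ₂·2t₁t₂, p) = 1. Suppose u/2 ≥ γ − u and ν_p(m) ≥ γ − u, where ν_p is the p-adic valuation. Then the character sum 𝔠_{γ,u} = Σ*_{a₁,a₂ mod p^u, λ₁a₁^{-1} − λ₂a₂^{-1} ≡ m (mod p^u)} S(1, (s₁p^{γ−u}a₁ + t₁)^{-1}; p^γ)·conj(S(1, (s₂p^{γ−u}a₂ + t₂)^{-1}; p^γ)) vanishes unless t₁^{-3/2}s₁λ₁ ≡ t₂^{-3/2}s₂λ₂ (mod p^{γ−u}) (for some choice of square roots of t₁, t₂ modulo p^{γ−u}), in which case |𝔠_{γ,u}| ≪ p^{γ+u}·p^{εu} for an absolute implied constant. -/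

import Mathlib

open Finset
open scoped Classical

/-- The Kloosterman sum `S(m, n; q)`, realized as a sum over pairs `(x, y)` with
`x·y ≡ 1 (mod q)`. -/
noncomputable def kloosterman (m n : ℤ) (q : ℕ) : ℂ :=
  ∑ x ∈ (Finset.range q ×ˢ Finset.range q).filter (fun x => x.1 * x.2 % q = 1 % q),
    Complex.exp (2 * Real.pi * Complex.I * (((m : ℂ) * x.1 + (n : ℂ) * x.2) / q))

/-- The character sum `𝔠_{γ,u}`: the sum over pairs of units `a₁, a₂ mod p^u`
(realized as quadruples `(a₁, b₁, a₂, b₂)` with `aⱼbⱼ ≡ 1 (mod p^u)`, so `bⱼ = aⱼ⁻¹`)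
satisfying `λ₁a₁⁻¹ − λ₂a₂⁻¹ ≡ m (mod p^u)`, of
`S(1, (s₁p^{γ−u}a₁+t₁)⁻¹; p^γ)·conj(S(1, (s₂p^{γ−u}a₂+t₂)⁻¹; p^γ))`, the inner inverses
being taken modulo `p^γ` (via `ZMod (p^γ)`). -/
noncomputable def charSum (p γ u : ℕ) (s₁ s₂ t₁ t₂ l₁ l₂ m : ℤ) : ℂ :=
  ∑ a ∈ ((Finset.range (p ^ u) ×ˢ Finset.range (p ^ u)) ×ˢ
        (Finset.range (p ^ u) ×ˢ Finset.range (p ^ u))).filter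
      (fun a => a.1.1 * a.1.2 % p ^ u = 1 % p ^ u ∧
        a.2.1 * a.2.2 % p ^ u = 1 % p ^ u ∧
        l₁ * a.1.2 - l₂ * a.2.2 ≡ m [ZMOD (p : ℤ) ^ u]),
    kloosterman 1
        (((((s₁ * (p : ℤ) ^ (γ - u) * a.1.1 + t₁ : ℤ) : ZMod (p ^ γ))⁻¹).val : ℤ) : ℤ)
        (p ^ γ) *
      (starRingEnd ℂ)
        (kloosterman 1
          (((((s₂ * (p : ℤ) ^ (γ - u) * a.2.1 + t₂ : ℤ) : ZMod (p ^ γ))⁻¹).val : ℤ) : ℤ)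
          (p ^ γ))

theorem Finset.sum_eq_zero_of_map_mul_eq {ι : Type*} (s : Finset ι) (σ : ι → ι)
    (hσ : ∀ x ∈ s, σ x ∈ s) (hinj : Function.Injective σ) (f ζ : ι → ℂ)
    (hf : ∀ x ∈ s, f (σ x) = ζ x * f x) (hζ : ∀ x ∈ s, ζ (σ x) = ζ x)
    (h1 : ∀ x ∈ s, ζ x ≠ 1) : ∑ x ∈ s, f x = 0 := by
  have himg : s.image σ = s :=
    Finset.eq_of_subset_of_card_le (by simpa [Finset.image_subset_iff] using hσ)
      (by rw [Finset.card_image_of_injective _ hinj])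
  have key : ∑ x ∈ s, f x / (ζ x - 1) = ∑ x ∈ s, f (σ x) / (ζ (σ x) - 1) := by
    conv_lhs => rw [← himg]
    exact Finset.sum_image fun a _ b _ h => hinj h
  calc ∑ x ∈ s, f x = ∑ x ∈ s, (f (σ x) / (ζ (σ x) - 1) - f x / (ζ x - 1)) := by
        refine Finset.sum_congr rfl fun x hx => ?_
        rw [hf x hx, hζ x hx]
        have := sub_ne_zero.mpr (h1 x hx)
        field_simp
    _ = 0 := by rw [Finset.sum_sub_distrib, key, sub_self]

/-- The unit `x + e` for `e` of square zero. -/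
def Units.addSqZero {R : Type*} [CommRing R] (x : Rˣ) (e : R) (he : e * e = 0) : Rˣ where
  val := x + e
  inv := ↑x⁻¹ - e * ↑x⁻¹ * ↑x⁻¹
  val_inv := by
    linear_combination (1 - e * (↑x⁻¹ : R)) * x.mul_inv - (↑x⁻¹ : R) * ↑x⁻¹ * he
  inv_val := by
    linear_combination (1 - e * (↑x⁻¹ : R)) * x.mul_inv - (↑x⁻¹ : R) * ↑x⁻¹ * he

section

variable {R : Type*} [CommRing R] [Fintype R] [DecidableEq R]

/-- A Kloosterman sum over the units of a finite commutative ring. -/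
noncomputable def unitKloosterman (ψ : AddChar R ℂ) (n : R) : ℂ :=
  ∑ x : Rˣ, ψ (x + n * ↑x⁻¹)

theorem unitKloosterman_eq_sum_stationary (ψ : AddChar R ℂ) (hψ : Function.Injective ψ)
    (n P : R) (hP : P * P = 0) :
    unitKloosterman ψ n =
      ∑ x ∈ Finset.univ.filter (fun x : Rˣ => P * ((x : R) - n * ↑x⁻¹) = 0),
        ψ (x + n * ↑x⁻¹) := by
  rw [unitKloosterman, ← Finset.sum_filter_add_sum_filter_not Finset.univ
    (fun x : Rˣ => P * ((x : R) - n * ↑x⁻¹) = 0), add_eq_left]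
  set w : Rˣ := Units.addSqZero 1 P hP
  have hw : (w : R) = 1 + P := by simp [w, Units.addSqZero]
  have hw' : ((w⁻¹ : Rˣ) : R) = 1 - P := by
    change ((1 : Rˣ)⁻¹ : Rˣ).val - P * ((1 : Rˣ)⁻¹ : Rˣ).val * ((1 : Rˣ)⁻¹ : Rˣ).val = 1 - P
    simp
  have hinv : ∀ x : Rˣ, P * (((x * w : Rˣ) : R) - n * ↑(x * w)⁻¹) = P * ((x : R) - n * ↑x⁻¹) := by
    intro x
    rw [mul_inv, Units.val_mul, Units.val_mul, hw, hw']
    linear_combination ((x : R) + n * ↑x⁻¹) * hP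
  refine Finset.sum_eq_zero_of_map_mul_eq _ (fun x => x * w) ?_ (mul_left_injective w) _
    (fun x => ψ (P * ((x : R) - n * ↑x⁻¹))) ?_ ?_ ?_
  · intro x hx
    simp only [Finset.mem_filter, Finset.mem_univ, true_and] at hx ⊢
    rwa [hinv]
  · intro x _
    rw [← AddChar.map_add_eq_mul, mul_inv, Units.val_mul, Units.val_mul, hw, hw']
    congr 1
    ring
  · intro x _
    simp only [hinv]
  · intro x hx
    simp only [Finset.mem_filter, Finset.mem_univ, true_and] at hx
    rwa [← AddChar.map_zero_eq_one ψ, hψ.ne_iff]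

/-- The pairs of units `(b₁, b₂)` with `l₁ b₁ - l₂ b₂ = m`. -/
noncomputable def linearPairs (l₁ l₂ m : R) : Finset (Rˣ × Rˣ) :=
  Finset.univ.filter fun b => l₁ * (b.1 : R) - l₂ * (b.2 : R) = m

theorem mem_linearPairs (l₁ l₂ m : R) (b : Rˣ × Rˣ) :
    b ∈ linearPairs l₁ l₂ m ↔ l₁ * (b.1 : R) - l₂ * (b.2 : R) = m := by
  simp [linearPairs]

theorem card_linearPairs_le (l₁ l₂ m : R) (hl : IsUnit l₂) :
    (linearPairs l₁ l₂ m).card ≤ Fintype.card R := by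
  rw [← Finset.card_univ]
  refine Finset.card_le_card_of_injOn (fun b => (b.1 : R)) (fun _ _ => by simp) ?_
  intro b hb c hc h
  rw [Finset.mem_coe, mem_linearPairs] at hb hc
  simp only at h
  refine Prod.ext (Units.ext h) (Units.ext (hl.mul_left_cancel ?_))
  linear_combination hc - hb + l₁ * h

omit [Fintype R] [DecidableEq R] in
theorem sum_linearPairs_eq_zero {R' : Type*} [CommRing R'] [Fintype R'] [DecidableEq R']
    (ρ : R →+* R') (L : R' → R) (hL : ∀ a, ρ (L a) = a) (π P Q : R)
    (hπ : ∀ α β, ρ α = ρ β → π * α = π * β) (hπQ : π * Q = P) (hPQ : P * Q = 0)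
    (hQ : ρ Q * ρ Q = 0) (hPP : P * P = 0)
    (hPπ : P * π = 0) (s₁ s₂ t₁ t₂ l₁ l₂ m X Z : R) (hm : P * m = 0)
    (hl₁ : IsUnit l₁)
    (n₁ n₂ : R' → R) (hn₁ : ∀ a, n₁ a * (s₁ * π * L a + t₁) = 1)
    (hn₂ : ∀ a, n₂ a * (s₂ * π * L a + t₂) = 1)
    (ψ : AddChar R ℂ) (hψ : Function.Injective ψ)
    (hX : P * (X ^ 2 - t₁) = 0) (hZ : P * (Z ^ 2 - t₂) = 0)
    (hne : P * (s₁ * l₁ * Z ^ 3 - s₂ * l₂ * X ^ 3) ≠ 0) :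
    ∑ b ∈ linearPairs (ρ l₁) (ρ l₂) (ρ m),
      ψ (n₁ ↑b.1⁻¹ * X - n₂ ↑b.2⁻¹ * Z) = 0 := by
  have hP : ∀ α β, ρ α = ρ β → P * α = P * β := by
    intro α β h
    rw [← hπQ]
    linear_combination Q * hπ α β h
  have sq : ∀ c : R', (ρ Q * c) * (ρ Q * c) = 0 := fun c => by linear_combination c * c * hQ
  -- effect of the shift on the lifted inverse
  have hLshift : ∀ (x : R'ˣ) (l : R),
      π * L (↑(x.addSqZero (ρ Q * ρ l) (sq _))⁻¹) = π * L ↑x⁻¹ - P * l * L ↑x⁻¹ * L ↑x⁻¹ := by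
    intro x l
    rw [hπ (L (↑(x.addSqZero (ρ Q * ρ l) (sq _))⁻¹)) (L ↑x⁻¹ - Q * l * L ↑x⁻¹ * L ↑x⁻¹)]
    · rw [← hπQ]; ring
    · simp only [map_sub, map_mul, hL]
      rfl
  have hPL : ∀ (x : R'ˣ) (l : R),
      P * L (↑(x.addSqZero (ρ Q * ρ l) (sq _))⁻¹) = P * L ↑x⁻¹ := by
    intro x l
    have := hLshift x l
    rw [← hπQ] at hPQ ⊢
    rw [← hπQ] at this
    linear_combination Q * this - l * L ↑x⁻¹ * L ↑x⁻¹ * hPQ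
  have hnshift : ∀ (n : R' → R) (s t : R), (∀ a, n a * (s * π * L a + t) = 1) →
      ∀ (x : R'ˣ) (l : R), n (↑(x.addSqZero (ρ Q * ρ l) (sq _))⁻¹)
        = n ↑x⁻¹ + P * (n ↑x⁻¹ ^ 2 * s * l * L ↑x⁻¹ ^ 2) := by
    intro n s t hn x l
    have h1 := hn ↑x⁻¹
    have h2 := hn (↑(x.addSqZero (ρ Q * ρ l) (sq _))⁻¹)
    have h3 := hLshift x l
    set a := n ↑x⁻¹
    set a' := n (↑(x.addSqZero (ρ Q * ρ l) (sq _))⁻¹)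
    set y := L ↑x⁻¹
    set y' := L (↑(x.addSqZero (ρ Q * ρ l) (sq _))⁻¹)
    have h4 : (a + P * (a ^ 2 * s * l * y ^ 2)) * (s * π * y' + t) = 1 := by
      linear_combination (1 + P * (a * s * l * y ^ 2)) * h1
        + (a + P * (a ^ 2 * s * l * y ^ 2)) * s * h3
        - (a ^ 2 * s * l * y ^ 2) * s * l * y * y * hPP
    linear_combination (a + P * (a ^ 2 * s * l * y ^ 2)) * h2 - a' * h4
  have hPn : ∀ (n : R' → R) (s t : R), (∀ a, n a * (s * π * L a + t) = 1) →
      ∀ a, P * (n a * t) = P := by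
    intro n s t hn a
    linear_combination P * hn a - n a * s * L a * hPπ
  refine Finset.sum_eq_zero_of_map_mul_eq _
    (fun b => (b.1.addSqZero (ρ Q * ρ l₂) (sq _), b.2.addSqZero (ρ Q * ρ l₁) (sq _))) ?_ ?_ _
    (fun b => ψ (P * (n₁ ↑b.1⁻¹ ^ 2 * s₁ * l₂ * L ↑b.1⁻¹ ^ 2 * X
      - n₂ ↑b.2⁻¹ ^ 2 * s₂ * l₁ * L ↑b.2⁻¹ ^ 2 * Z))) ?_ ?_ ?_
  · intro b hb
    rw [mem_linearPairs] at hb ⊢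
    simp only [Units.addSqZero]
    linear_combination hb
  · intro b c h
    simp only [Prod.mk.injEq] at h
    have h1 := congrArg Units.val h.1
    have h2 := congrArg Units.val h.2
    simp only [Units.addSqZero, add_left_inj] at h1 h2
    exact Prod.ext (Units.ext h1) (Units.ext h2)
  · intro b _
    rw [← AddChar.map_add_eq_mul]
    congr 1
    simp only [hnshift n₁ s₁ t₁ hn₁, hnshift n₂ s₂ t₂ hn₂]
    ring
  · intro b _
    simp only
    congr 1
    have e1 := hPL b.1 l₂
    have e2 := hPL b.2 l₁
    rw [hnshift n₁ s₁ t₁ hn₁, hnshift n₂ s₂ t₂ hn₂]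
    set a := n₁ ↑b.1⁻¹
    set c := n₂ ↑b.2⁻¹
    set y := L ↑b.1⁻¹
    set y' := L (↑(b.1.addSqZero (ρ Q * ρ l₂) (sq _))⁻¹)
    set v := L ↑b.2⁻¹
    set v' := L (↑(b.2.addSqZero (ρ Q * ρ l₁) (sq _))⁻¹)
    have i1 : P * (a + P * (a ^ 2 * s₁ * l₂ * y ^ 2)) = P * a := by
      linear_combination (a ^ 2 * s₁ * l₂ * y ^ 2) * hPP
    have i2 : P * (c + P * (c ^ 2 * s₂ * l₁ * v ^ 2)) = P * c := by
      linear_combination (c ^ 2 * s₂ * l₁ * v ^ 2) * hPP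
    generalize a + P * (a ^ 2 * s₁ * l₂ * y ^ 2) = a' at *
    generalize c + P * (c ^ 2 * s₂ * l₁ * v ^ 2) = c' at *
    linear_combination (s₁ * l₂ * X) * (y' ^ 2 * (a' + a) * i1 + a ^ 2 * (y' + y) * e1)
      - (s₂ * l₁ * Z) * (v' ^ 2 * (c' + c) * i2 + c ^ 2 * (v' + v) * e2)
  · intro b hb
    rw [← AddChar.map_zero_eq_one ψ, hψ.ne_iff]
    intro h0
    apply hne
    rw [mem_linearPairs] at hb
    have k1 := hPn n₁ s₁ t₁ hn₁ ↑b.1⁻¹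
    have k2 := hPn n₂ s₂ t₂ hn₂ ↑b.2⁻¹
    set a := n₁ ↑b.1⁻¹
    set c := n₂ ↑b.2⁻¹
    set y := L ↑b.1⁻¹ with hy
    set v := L ↑b.2⁻¹ with hv
    have hyv : P * (l₁ * v) = P * (l₂ * y) := by
      have h1 : P * (l₁ * v - l₂ * y) = P * (m * y * v) := by
        apply hP
        simp only [map_sub, map_mul, hy, hv, hL]
        rw [← hb]
        linear_combination (-(ρ l₁) * (↑b.2⁻¹ : R')) * b.1.mul_inv
          + (ρ l₂) * (↑b.1⁻¹ : R') * b.2.mul_inv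
      linear_combination h1 + y * v * hm
    have hvu : P * (v * L b.2) = P := by
      have := hP (v * L b.2) 1 (by simp [hv, hL])
      simpa using this
    obtain ⟨l, hl⟩ := hl₁.exists_left_inv
    have k3 : P * (a * X ^ 2) = P := by linear_combination a * hX + k1
    have k4 : P * (c * Z ^ 2) = P := by linear_combination c * hZ + k2
    have k5 : P * (a * X ^ 2) ^ 2 = P := by linear_combination (a * X ^ 2 + 1) * k3
    have k6 : P * (c * Z ^ 2) ^ 2 = P := by linear_combination (c * Z ^ 2 + 1) * k4
    have h5 : P * (l₁ * v ^ 2 * (s₁ * l₁ * Z ^ 3 - s₂ * l₂ * X ^ 3)) = 0 := by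
      linear_combination l₂ * X ^ 3 * Z ^ 3 * h0
        + a ^ 2 * s₁ * X ^ 4 * Z ^ 3 * (l₁ * v + l₂ * y) * hyv
        - s₁ * l₁ ^ 2 * v ^ 2 * Z ^ 3 * k5 + s₂ * l₁ * l₂ * v ^ 2 * X ^ 3 * k6
    linear_combination l * L b.2 ^ 2 * h5
      - P * (s₁ * l₁ * Z ^ 3 - s₂ * l₂ * X ^ 3) * v ^ 2 * L b.2 ^ 2 * hl
      - (s₁ * l₁ * Z ^ 3 - s₂ * l₂ * X ^ 3) * (v * L b.2 + 1) * hvu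
end

theorem sum_filter_mul_mod_eq_one {q : ℕ} [NeZero q] (F : ℕ → ℕ → ℂ) :
    ∑ x ∈ (Finset.range q ×ˢ Finset.range q).filter (fun x => x.1 * x.2 % q = 1 % q),
      F x.1 x.2 = ∑ v : (ZMod q)ˣ, F (↑v⁻¹ : ZMod q).val (v : ZMod q).val := by
  have hone : ∀ a b : ℕ, a * b % q = 1 % q ↔ (a : ZMod q) * b = 1 := by
    intro a b
    have := ZMod.natCast_eq_natCast_iff (a * b) 1 q
    rw [Nat.cast_mul, Nat.cast_one] at this
    exact this.symm
  symm
  refine Finset.sum_bij' (fun v _ => ((↑v⁻¹ : ZMod q).val, (v : ZMod q).val))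
    (fun x hx => ⟨x.2, x.1, ?_, ?_⟩) ?_ ?_ ?_ ?_ ?_
  · rw [mul_comm]
    exact (hone _ _).1 (Finset.mem_filter.1 hx).2
  · exact (hone _ _).1 (Finset.mem_filter.1 hx).2
  · intro v _
    simp only [Finset.mem_filter, Finset.mem_product, Finset.mem_range, hone,
      ZMod.natCast_zmod_val, Units.inv_mul, and_true]
    exact ⟨ZMod.val_lt _, ZMod.val_lt _⟩
  · simp
  · intro v _
    ext
    simp
  · intro x hx
    simp only [Finset.mem_filter, Finset.mem_product, Finset.mem_range] at hx
    simp [ZMod.val_cast_of_lt hx.1.1, ZMod.val_cast_of_lt hx.1.2]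
  · simp

theorem kloosterman_one_val {q : ℕ} [NeZero q] (n : ZMod q) :
    kloosterman 1 ((n.val : ℤ) : ℤ) q = unitKloosterman ZMod.stdAddChar n := by
  rw [kloosterman, sum_filter_mul_mod_eq_one (fun a b : ℕ =>
    Complex.exp (2 * Real.pi * Complex.I * ((((1 : ℤ) : ℂ) * a + (((n.val : ℤ) : ℤ) : ℂ) * b) / q))),
    unitKloosterman, ← Equiv.sum_comp (Equiv.inv (ZMod q)ˣ)]
  refine Finset.sum_congr rfl fun v _ => ?_
  have h : (v : ZMod q) + n * ↑v⁻¹ =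
      (((1 : ℤ) * ((↑(v⁻¹)⁻¹ : ZMod q).val : ℤ) + (n.val : ℤ) * ((↑v⁻¹ : ZMod q).val : ℤ) : ℤ) :
        ZMod q) := by
    simp
  rw [Equiv.inv_apply, h, ZMod.stdAddChar_coe]
  congr 1
  push_cast
  ring

theorem ZMod.pow_mul_eq_zero_iff {p i g N : ℕ} (hN : p ^ (i + g) = N) (hp : p.Prime)
    (y : ZMod N) :
    (p : ZMod N) ^ i * y = 0 ↔ ∃ z, y = (p : ZMod N) ^ g * z := by
  have hpos : (p : ℤ) ^ i ≠ 0 := pow_ne_zero _ (by exact_mod_cast hp.ne_zero)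
  constructor
  · intro h
    obtain ⟨y, rfl⟩ := ZMod.intCast_surjective y
    have h1 : (((p : ℤ) ^ i * y : ℤ) : ZMod N) = 0 := by exact_mod_cast h
    rw [ZMod.intCast_zmod_eq_zero_iff_dvd, ← hN] at h1
    push_cast at h1
    rw [pow_add, mul_dvd_mul_iff_left hpos] at h1
    obtain ⟨z, rfl⟩ := h1
    exact ⟨z, by push_cast; rfl⟩
  · rintro ⟨z, rfl⟩
    rw [← mul_assoc, ← pow_add]
    have h : ((p ^ (i + g) : ℕ) : ZMod N) = 0 := by rw [hN, ZMod.natCast_self]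
    push_cast at h
    rw [h, zero_mul]

theorem ZMod.card_pow_mul_eq_zero_le {p i g N : ℕ} (hN : p ^ (i + g) = N) (hp : p.Prime)
    [NeZero N] :
    (Finset.univ.filter fun y : ZMod N =>
      (p : ZMod N) ^ i * y = 0).card ≤ p ^ i := by
  calc _ ≤ ((Finset.range (p ^ i)).image
        fun t : ℕ => (p : ZMod N) ^ g * (t : ZMod N)).card := by
        refine Finset.card_le_card fun y hy => ?_
        rw [Finset.mem_filter, ZMod.pow_mul_eq_zero_iff hN hp] at hy
        obtain ⟨-, z, rfl⟩ := hy
        refine Finset.mem_image.2 ⟨z.val % p ^ i,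
          Finset.mem_range.2 (Nat.mod_lt _ (pow_pos hp.pos _)), ?_⟩
        have h0 : (p : ZMod N) ^ g * (p : ZMod N) ^ i = 0 := by
          rw [mul_comm]
          exact (ZMod.pow_mul_eq_zero_iff hN hp _).2 ⟨1, by simp⟩
        have hz := congrArg (Nat.cast : ℕ → ZMod N) (Nat.mod_add_div z.val (p ^ i))
        rw [ZMod.natCast_zmod_val] at hz
        push_cast at hz ⊢
        linear_combination (p : ZMod N) ^ g * hz
          - ((z.val / p ^ i : ℕ) : ZMod N) * h0
    _ ≤ p ^ i := Finset.card_image_le.trans (by simp)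

theorem ZMod.isUnit_or_exists_eq_mul {p γ N : ℕ} (hN : p ^ γ = N) (hp : p.Prime) (hγ : 0 < γ)
    (y : ZMod N) : IsUnit y ∨ ∃ z, y = (p : ZMod N) * z := by
  subst hN
  have : NeZero (p ^ γ) := ⟨pow_ne_zero _ hp.ne_zero⟩
  rw [← ZMod.natCast_zmod_val y, ZMod.isUnit_natCast_iff_not_dvd_pow hp hγ]
  by_cases h : p ∣ y.val
  · obtain ⟨z, hz⟩ := h
    exact Or.inr ⟨z, by rw [hz]; push_cast; rfl⟩
  · exact Or.inl h

theorem ZMod.card_stationary_le {p i g N : ℕ} (hN : p ^ (i + g) = N) (hp : p.Prime)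
    (hp2 : p ≠ 2) [NeZero N] (hig : 0 < i + g) (n : ZMod N) :
    (Finset.univ.filter fun x : (ZMod N)ˣ =>
      (p : ZMod N) ^ i * ((x : ZMod N) - n * (↑x⁻¹ : ZMod N))
        = 0).card ≤ 2 * p ^ i := by
  have h2 : IsUnit (2 : ZMod N) := by
    subst hN
    have := (ZMod.isUnit_natCast_iff_not_dvd_pow (a := 2) hp hig).2
      (fun h => hp2 ((Nat.prime_dvd_prime_iff_eq hp Nat.prime_two).1 h))
    exact_mod_cast this
  have hpu : ¬ IsUnit (p : ZMod N) := by
    subst hN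
    exact fun h => (ZMod.isUnit_natCast_iff_not_dvd_pow hp hig).1 h dvd_rfl
  rcases Finset.eq_empty_or_nonempty (Finset.univ.filter fun x : (ZMod N)ˣ =>
    (p : ZMod N) ^ i * ((x : ZMod N) - n * (↑x⁻¹ : ZMod N)) = 0) with h | ⟨x₀, hx₀⟩
  · rw [h]; simp
  have hsq : ∀ x : (ZMod N)ˣ, (p : ZMod N) ^ i * ((x : ZMod N) - n * (↑x⁻¹ : ZMod N)) = 0 →
      (p : ZMod N) ^ i * ((x : ZMod N) ^ 2 - n) = 0 := by
    intro x h
    linear_combination (x : ZMod N) * h + (p : ZMod N) ^ i * n * x.mul_inv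
  have hsub : ∀ c : ZMod N, (Finset.univ.filter fun x : (ZMod N)ˣ =>
      (p : ZMod N) ^ i * ((x : ZMod N) - c) = 0).card ≤ p ^ i := by
    intro c
    refine (Finset.card_le_card_of_injOn (fun x : (ZMod N)ˣ => (x : ZMod N) - c) ?_ ?_).trans
      (ZMod.card_pow_mul_eq_zero_le hN hp)
    · intro x hx
      simpa using hx
    · intro x _ y _ h
      exact Units.ext (sub_left_injective h)
  calc _ ≤ ((Finset.univ.filter fun x : (ZMod N)ˣ =>
          (p : ZMod N) ^ i * ((x : ZMod N) - x₀) = 0) ∪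
        (Finset.univ.filter fun x : (ZMod N)ˣ =>
          (p : ZMod N) ^ i * ((x : ZMod N) - (-x₀)) = 0)).card := by
        refine Finset.card_le_card fun x hx => ?_
        simp only [Finset.mem_filter, Finset.mem_univ, true_and, Finset.mem_union] at hx hx₀ ⊢
        have h1 : (p : ZMod N) ^ i * (((x : ZMod N) - x₀) * ((x : ZMod N) - (-x₀))) = 0 := by
          linear_combination hsq x hx - hsq x₀ hx₀
        rcases ZMod.isUnit_or_exists_eq_mul hN hp hig ((x : ZMod N) - x₀) with h | ⟨z, hz⟩
        · right
          rw [mul_left_comm] at h1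
          exact h.mul_right_eq_zero.1 h1
        · left
          rcases ZMod.isUnit_or_exists_eq_mul hN hp hig ((x : ZMod N) - (-x₀)) with h | ⟨z', hz'⟩
          · rw [← mul_assoc] at h1
            exact h.mul_left_eq_zero.1 h1
          · refine absurd (isUnit_of_dvd_unit ?_ (h2.mul x.isUnit)) hpu
            exact ⟨z + z', by linear_combination hz + hz'⟩
    _ ≤ p ^ i + p ^ i := (Finset.card_union_le _ _).trans (add_le_add (hsub _) (hsub _))
    _ = 2 * p ^ i := by ring

theorem ZMod.norm_sq_quadratic_sum {p : ℕ} [Fact p.Prime] (hp2 : p ≠ 2) (α β : ZMod p)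
    (hβ : β ≠ 0) :
    ‖∑ v : ZMod p, ZMod.stdAddChar (α * v + β * v ^ 2)‖ ^ 2 = p := by
  have h2 : (2 : ZMod p) ≠ 0 := by
    intro h
    have h' : ((2 : ℕ) : ZMod p) = 0 := by exact_mod_cast h
    rw [ZMod.natCast_eq_zero_iff] at h'
    exact hp2 ((Nat.prime_dvd_prime_iff_eq Fact.out Nat.prime_two).1 h')
  have key : (∑ v : ZMod p, ZMod.stdAddChar (α * v + β * v ^ 2)) *
      (starRingEnd ℂ) (∑ v : ZMod p, ZMod.stdAddChar (α * v + β * v ^ 2)) = (p : ℂ) := by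
    rw [map_sum, Finset.sum_mul_sum, Finset.sum_comm]
    calc ∑ w : ZMod p, ∑ v : ZMod p, (ZMod.stdAddChar (α * v + β * v ^ 2) : ℂ) *
          (starRingEnd ℂ) (ZMod.stdAddChar (α * w + β * w ^ 2))
        = ∑ w : ZMod p, ∑ d : ZMod p, (ZMod.stdAddChar (α * d + β * d ^ 2) : ℂ) *
            ZMod.stdAddChar (w * (2 * β * d)) := by
          refine Finset.sum_congr rfl fun w _ => ?_
          rw [← Equiv.sum_comp (Equiv.addRight w)]
          refine Finset.sum_congr rfl fun d _ => ?_
          rw [← AddChar.map_neg_eq_conj, ← AddChar.map_add_eq_mul, ← AddChar.map_add_eq_mul]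
          congr 1
          simp only [Equiv.coe_addRight]
          ring
      _ = ∑ d : ZMod p, (ZMod.stdAddChar (α * d + β * d ^ 2) : ℂ) *
            ∑ w : ZMod p, ZMod.stdAddChar (w * (2 * β * d)) := by
          rw [Finset.sum_comm]
          simp only [Finset.mul_sum]
      _ = ∑ d : ZMod p, if d = 0 then (p : ℂ) else 0 := by
          refine Finset.sum_congr rfl fun d _ => ?_
          rw [AddChar.sum_mulShift _ (ZMod.isPrimitive_stdAddChar p)]
          by_cases hd : d = 0
          · simp [hd, ZMod.card]
          · simp [hd, h2, hβ]
      _ = p := by simp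
  rw [Complex.mul_conj, Complex.normSq_eq_norm_sq] at key
  exact_mod_cast key

theorem ZMod.stdAddChar_pow_mul {p a N : ℕ} (hN : p ^ (a + 1) = N) [NeZero p] [NeZero N]
    (h : p ∣ N) (y : ZMod N) :
    (ZMod.stdAddChar ((p : ZMod N) ^ a * y) : ℂ) =
      ZMod.stdAddChar (ZMod.castHom h (ZMod p) y) := by
  obtain ⟨y, rfl⟩ := ZMod.intCast_surjective y
  have h1 : (p : ZMod N) ^ a * (y : ZMod N) = (((p : ℤ) ^ a * y : ℤ) : ZMod N) := by push_cast; rfl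
  rw [h1, map_intCast (ZMod.castHom h (ZMod p)), ZMod.stdAddChar_coe, ZMod.stdAddChar_coe]
  congr 1
  have : (p : ℂ) ≠ 0 := Nat.cast_ne_zero.2 (NeZero.ne p)
  rw [← hN]
  push_cast
  field_simp
  ring

theorem unitKloosterman_norm_sq_le_even {p g N : ℕ} (hN : p ^ (g + g) = N) (hp : p.Prime)
    (hp2 : p ≠ 2) [NeZero N] (hg : 0 < g) (n : ZMod N) :
    ‖unitKloosterman ZMod.stdAddChar n‖ ^ 2 ≤ 4 * (p : ℝ) ^ (g + g) := by
  have hP : (p : ZMod N) ^ g * (p : ZMod N) ^ g = 0 :=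
    (ZMod.pow_mul_eq_zero_iff hN hp _).2 ⟨1, by simp⟩
  have hle : ‖unitKloosterman ZMod.stdAddChar n‖ ≤ 2 * (p : ℝ) ^ g := by
    rw [unitKloosterman_eq_sum_stationary _ ZMod.injective_stdAddChar n _ hP]
    refine (norm_sum_le _ _).trans ?_
    simp only [AddChar.norm_apply, Finset.sum_const, nsmul_eq_mul, mul_one]
    exact_mod_cast ZMod.card_stationary_le hN hp hp2 (by omega) n
  calc _ ≤ (2 * (p : ℝ) ^ g) ^ 2 := by gcongr
    _ = _ := by ring

theorem unitKloosterman_norm_sq_le_odd {p g N : ℕ} (hN : p ^ (g + 1 + g) = N) (hp : p.Prime)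
    (hp2 : p ≠ 2) [NeZero N] (hg : 0 < g) (n : ZMod N) (hn : IsUnit n) :
    ‖unitKloosterman ZMod.stdAddChar n‖ ^ 2 ≤ 4 * (p : ℝ) ^ (g + 1 + g) := by
  have : Fact p.Prime := ⟨hp⟩
  have hdvd : p ∣ N := hN ▸ dvd_pow_self p (by omega)
  have hchar : ∀ y : ZMod N, (ZMod.stdAddChar ((p : ZMod N) ^ (2 * g) * y) : ℂ) =
      ZMod.stdAddChar (ZMod.castHom hdvd (ZMod p) y) :=
    ZMod.stdAddChar_pow_mul (by rw [← hN]; ring) hdvd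
  have hPη : (p : ZMod N) ^ (g + 1) * (p : ZMod N) ^ g = 0 :=
    (ZMod.pow_mul_eq_zero_iff hN hp _).2 ⟨1, by simp⟩
  set η : ZMod N := (p : ZMod N) ^ g with hη
  set P : ZMod N := (p : ZMod N) ^ (g + 1) with hPdef
  have hPp : P = p * η := pow_succ' _ _
  obtain ⟨e, rfl⟩ : ∃ e, g = e + 1 := ⟨g - 1, by omega⟩
  have hηp : η = (p : ZMod N) ^ e * p := pow_succ _ _
  have hη3 : η * η * η = 0 := by
    rw [hPp] at hPη
    linear_combination (p : ZMod N) ^ e * hPη + η * η * hηp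
  have hPP : P * P = 0 := by
    rw [hPp] at hPη ⊢
    linear_combination (p : ZMod N) * hPη
  let w : ZMod p → (ZMod N)ˣ := fun v =>
    ⟨1 + η * (v.val : ZMod N), 1 - η * (v.val : ZMod N) + η * η * (v.val : ZMod N) ^ 2,
      by linear_combination (v.val : ZMod N) ^ 3 * hη3,
      by linear_combination (v.val : ZMod N) ^ 3 * hη3⟩
  have hw : ∀ v, (w v : ZMod N) = 1 + η * (v.val : ZMod N) := fun _ => rfl
  have hw' : ∀ v, ((w v)⁻¹ : (ZMod N)ˣ).val = 1 - η * (v.val : ZMod N) + η * η * (v.val : ZMod N) ^ 2 :=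
    fun _ => rfl
  set X : Finset (ZMod N)ˣ := Finset.univ.filter fun x : (ZMod N)ˣ =>
    P * ((x : ZMod N) - n * (↑x⁻¹ : ZMod N)) = 0 with hX
  have hS := unitKloosterman_eq_sum_stationary ZMod.stdAddChar ZMod.injective_stdAddChar n P hPP
  rw [← hX] at hS
  have hinv : ∀ v x, x * w v ∈ X ↔ x ∈ X := by
    intro v x
    simp only [hX, Finset.mem_filter, Finset.mem_univ, true_and]
    have : P * (((x * w v : (ZMod N)ˣ) : ZMod N) - n * ↑(x * w v)⁻¹) =
        P * ((x : ZMod N) - n * ↑x⁻¹) := by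
      rw [mul_inv, Units.val_mul, Units.val_mul, hw, hw']
      linear_combination ((x : ZMod N) * v.val + n * ↑x⁻¹ * v.val
        - n * ↑x⁻¹ * η * (v.val : ZMod N) ^ 2) * hPη
    rw [this]
  have hshift : ∀ v : ZMod p, unitKloosterman ZMod.stdAddChar n =
      ∑ x ∈ X, (ZMod.stdAddChar ((x : ZMod N) + n * (↑x⁻¹ : ZMod N)) : ℂ) *
        ZMod.stdAddChar (η * (v.val : ZMod N) * ((x : ZMod N) - n * (↑x⁻¹ : ZMod N)) +
          η * η * (v.val : ZMod N) ^ 2 * (n * (↑x⁻¹ : ZMod N))) := by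
    intro v
    rw [hS]
    symm
    refine Finset.sum_equiv (Equiv.mulRight (w v)) (fun x => (hinv v x).symm) ?_
    intro x _
    rw [← AddChar.map_add_eq_mul, Equiv.coe_mulRight, mul_inv, Units.val_mul, Units.val_mul,
      hw, hw']
    congr 1
    ring
  have hsum : (p : ℂ) * unitKloosterman ZMod.stdAddChar n =
      ∑ x ∈ X, (ZMod.stdAddChar ((x : ZMod N) + n * (↑x⁻¹ : ZMod N)) : ℂ) * ∑ v : ZMod p,
        ZMod.stdAddChar (η * (v.val : ZMod N) * ((x : ZMod N) - n * (↑x⁻¹ : ZMod N)) +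
          η * η * (v.val : ZMod N) ^ 2 * (n * (↑x⁻¹ : ZMod N))) := by
    simp only [Finset.mul_sum]
    rw [Finset.sum_comm, ← Finset.sum_congr rfl fun v _ => hshift v]
    simp [ZMod.card]
  have hinner : ∀ x ∈ X, ‖∑ v : ZMod p, (ZMod.stdAddChar
      (η * (v.val : ZMod N) * ((x : ZMod N) - n * (↑x⁻¹ : ZMod N)) +
        η * η * (v.val : ZMod N) ^ 2 * (n * (↑x⁻¹ : ZMod N))) : ℂ)‖ = √p := by
    intro x hx
    rw [hX, Finset.mem_filter, hPdef, ZMod.pow_mul_eq_zero_iff hN hp] at hx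
    obtain ⟨-, A, hA⟩ := hx
    have hu : IsUnit (ZMod.castHom hdvd (ZMod p) (n * (↑x⁻¹ : ZMod N))) :=
      (hn.mul (x⁻¹).isUnit).map _
    rw [← ZMod.norm_sq_quadratic_sum hp2 (ZMod.castHom hdvd (ZMod p) A) _ hu.ne_zero,
      Real.sqrt_sq (norm_nonneg _)]
    congr 1
    refine Finset.sum_congr rfl fun v _ => ?_
    have : ZMod.castHom hdvd (ZMod p) A * v + ZMod.castHom hdvd (ZMod p) (n * (↑x⁻¹ : ZMod N)) * v ^ 2 =
        ZMod.castHom hdvd (ZMod p) (A * (v.val : ZMod N) + n * (↑x⁻¹ : ZMod N) * (v.val : ZMod N) ^ 2) := by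
      simp only [map_add, map_mul, map_pow, map_natCast, ZMod.natCast_zmod_val]
    rw [this, ← hchar]
    congr 1
    rw [hA]
    ring
  have hcard : (X.card : ℝ) ≤ 2 * (p : ℝ) ^ (e + 1 + 1) := by
    have h : X.card ≤ 2 * p ^ (e + 1 + 1) := ZMod.card_stationary_le hN hp hp2 (by omega) n
    exact_mod_cast h
  have hnorm : (p : ℝ) * ‖unitKloosterman ZMod.stdAddChar n‖ ≤
      2 * (p : ℝ) ^ (e + 1 + 1) * √p := by
    calc (p : ℝ) * ‖unitKloosterman ZMod.stdAddChar n‖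
        = ‖(p : ℂ) * unitKloosterman ZMod.stdAddChar n‖ := by simp
      _ ≤ ∑ x ∈ X, √p := by
        rw [hsum]
        refine (norm_sum_le _ _).trans (Finset.sum_le_sum fun x hx => ?_)
        rw [norm_mul, hinner x hx, AddChar.norm_apply, one_mul]
      _ ≤ _ := by
        rw [Finset.sum_const, nsmul_eq_mul]
        gcongr
  have hp0 : (0 : ℝ) < p := by exact_mod_cast hp.pos
  have hle : ‖unitKloosterman ZMod.stdAddChar n‖ ≤ 2 * (p : ℝ) ^ (e + 1) * √p := by
    refine le_of_mul_le_mul_left (hnorm.trans (le_of_eq ?_)) hp0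
    ring
  calc _ ≤ (2 * (p : ℝ) ^ (e + 1) * √p) ^ 2 := by gcongr
    _ = _ := by
      rw [mul_pow, Real.sq_sqrt hp0.le]
      ring

theorem unitKloosterman_norm_sq_le {p γ : ℕ} (hp : p.Prime) (hp2 : p ≠ 2) (hγ : 2 ≤ γ)
    [NeZero (p ^ γ)] (n : ZMod (p ^ γ)) (hn : IsUnit n) :
    ‖unitKloosterman ZMod.stdAddChar n‖ ^ 2 ≤ 4 * (p : ℝ) ^ γ := by
  rcases Nat.even_or_odd γ with ⟨g, rfl⟩ | ⟨g, hg⟩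
  · exact unitKloosterman_norm_sq_le_even rfl hp hp2 (by omega) n
  · obtain rfl : γ = g + 1 + g := by omega
    exact unitKloosterman_norm_sq_le_odd rfl hp hp2 (by omega) n hn

/-- The second argument `(s p^k a + t)⁻¹` of the Kloosterman sums in `charSum`. -/
noncomputable def progressionInv (p u k : ℕ) (s t : ℤ) (a : ZMod (p ^ u)) : ZMod (p ^ (u + k)) :=
  ((s : ZMod (p ^ (u + k))) * (p : ZMod (p ^ (u + k))) ^ k * (a.val : ZMod (p ^ (u + k))) + t)⁻¹

theorem charSum_eq_sum_linearPairs {p u k : ℕ} [NeZero (p ^ u)] [NeZero (p ^ (u + k))]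
    (s₁ s₂ t₁ t₂ l₁ l₂ m : ℤ) :
    charSum p (u + k) u s₁ s₂ t₁ t₂ l₁ l₂ m =
      ∑ b ∈ linearPairs (l₁ : ZMod (p ^ u)) l₂ m,
        unitKloosterman ZMod.stdAddChar (progressionInv p u k s₁ t₁ ↑b.1⁻¹) *
          (starRingEnd ℂ)
            (unitKloosterman ZMod.stdAddChar (progressionInv p u k s₂ t₂ ↑b.2⁻¹)) := by
  have hK : ∀ (s t : ℤ) (a : ZMod (p ^ u)),
      ((((s * (p : ℤ) ^ (u + k - u) * (a.val : ℕ) + t : ℤ) : ZMod (p ^ (u + k)))⁻¹)) =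
        progressionInv p u k s t a := by
    intro s t a
    rw [progressionInv, Nat.add_sub_cancel_left]
    push_cast
    rfl
  have hm : ∀ v w : ZMod (p ^ u), (l₁ * (v.val : ℤ) - l₂ * (w.val : ℤ) ≡ m [ZMOD (p : ℤ) ^ u]) ↔
      (l₁ : ZMod (p ^ u)) * v - l₂ * w = m := by
    intro v w
    have := ZMod.intCast_eq_intCast_iff (l₁ * (v.val : ℤ) - l₂ * (w.val : ℤ)) m (p ^ u)
    push_cast [ZMod.natCast_zmod_val] at this
    exact this.symm
  let F : ℕ → ℕ → ℕ → ℕ → ℂ := fun a b c d =>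
    if l₁ * (b : ℤ) - l₂ * (d : ℤ) ≡ m [ZMOD (p : ℤ) ^ u] then
      kloosterman 1
        (((((s₁ * (p : ℤ) ^ (u + k - u) * a + t₁ : ℤ) : ZMod (p ^ (u + k)))⁻¹).val : ℤ) : ℤ)
        (p ^ (u + k)) *
      (starRingEnd ℂ)
        (kloosterman 1
          (((((s₂ * (p : ℤ) ^ (u + k - u) * c + t₂ : ℤ) : ZMod (p ^ (u + k)))⁻¹).val : ℤ) : ℤ)
          (p ^ (u + k)))
    else 0
  calc charSum p (u + k) u s₁ s₂ t₁ t₂ l₁ l₂ m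
      = ∑ x ∈ (Finset.range (p ^ u) ×ˢ Finset.range (p ^ u)).filter
            (fun x => x.1 * x.2 % p ^ u = 1 % p ^ u),
          ∑ y ∈ (Finset.range (p ^ u) ×ˢ Finset.range (p ^ u)).filter
            (fun x => x.1 * x.2 % p ^ u = 1 % p ^ u), F x.1 x.2 y.1 y.2 := by
        rw [← Finset.sum_product', ← Finset.filter_product, ← Finset.sum_filter,
          Finset.filter_filter, charSum]
        simp only [and_assoc]
    _ = ∑ v : (ZMod (p ^ u))ˣ, ∑ w : (ZMod (p ^ u))ˣ,
          F (↑v⁻¹ : ZMod (p ^ u)).val (v : ZMod (p ^ u)).val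
            (↑w⁻¹ : ZMod (p ^ u)).val (w : ZMod (p ^ u)).val := by
        rw [sum_filter_mul_mod_eq_one (fun a b => ∑ y ∈ (Finset.range (p ^ u) ×ˢ
          Finset.range (p ^ u)).filter (fun x => x.1 * x.2 % p ^ u = 1 % p ^ u), F a b y.1 y.2)]
        exact Finset.sum_congr rfl fun v _ => sum_filter_mul_mod_eq_one (F _ _)
    _ = _ := by
        rw [← Fintype.sum_prod_type', linearPairs, Finset.sum_filter]
        refine Finset.sum_congr rfl fun b _ => ?_
        simp only [F, hm, hK, kloosterman_one_val]

theorem isUnit_progression {p u k : ℕ} (hk : 0 < k) (s t : ℤ)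
    (ht : IsCoprime (p : ℤ) t) (a : ZMod (p ^ u)) :
    IsUnit ((s : ZMod (p ^ (u + k))) * (p : ZMod (p ^ (u + k))) ^ k *
      (a.val : ZMod (p ^ (u + k))) + t) := by
  have h : IsUnit ((s * (p : ℤ) ^ k * (a.val : ℤ) + t : ℤ) : ZMod (p ^ (u + k))) := by
    rw [ZMod.coe_int_isUnit_iff_isCoprime]
    push_cast
    refine IsCoprime.pow_left ?_
    obtain ⟨j, rfl⟩ : ∃ j, k = j + 1 := ⟨k - 1, by omega⟩
    rw [show s * (p : ℤ) ^ (j + 1) * (a.val : ℤ) + t = t + (p : ℤ) * (s * p ^ j * a.val) by ring]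
    exact ht.add_mul_left_right _
  exact_mod_cast h

theorem norm_charSum_le {p u k : ℕ} (hp : p.Prime) (hp2 : p ≠ 2) (hk : 0 < k) (huk : 2 ≤ u + k)
    (s₁ s₂ t₁ t₂ l₁ l₂ m : ℤ) (ht₁ : IsCoprime (p : ℤ) t₁) (ht₂ : IsCoprime (p : ℤ) t₂)
    (hl₂ : IsCoprime (p : ℤ) l₂) :
    ‖charSum p (u + k) u s₁ s₂ t₁ t₂ l₁ l₂ m‖ ≤ 4 * (p : ℝ) ^ (u + k + u) := by
  have : NeZero (p ^ u) := ⟨pow_ne_zero _ hp.ne_zero⟩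
  have : NeZero (p ^ (u + k)) := ⟨pow_ne_zero _ hp.ne_zero⟩
  have hl : IsUnit (l₂ : ZMod (p ^ u)) := by
    rw [ZMod.coe_int_isUnit_iff_isCoprime]
    push_cast
    exact hl₂.pow_left
  have hK : ∀ s t : ℤ, IsCoprime (p : ℤ) t → ∀ a : ZMod (p ^ u),
      ‖unitKloosterman ZMod.stdAddChar (progressionInv p u k s t a)‖ ^ 2 ≤
        4 * (p : ℝ) ^ (u + k) := by
    intro s t ht a
    refine unitKloosterman_norm_sq_le hp hp2 huk _ ?_
    exact IsUnit.of_mul_eq_one _ (ZMod.inv_mul_of_unit _ (isUnit_progression hk s t ht a))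
  rw [charSum_eq_sum_linearPairs]
  calc _ ≤ ∑ b ∈ linearPairs (l₁ : ZMod (p ^ u)) l₂ m, 4 * (p : ℝ) ^ (u + k) := by
        refine (norm_sum_le _ _).trans (Finset.sum_le_sum fun b _ => ?_)
        rw [norm_mul, RCLike.norm_conj]
        have h1 := hK s₁ t₁ ht₁ ↑b.1⁻¹
        have h2 := hK s₂ t₂ ht₂ ↑b.2⁻¹
        nlinarith [sq_nonneg (‖unitKloosterman ZMod.stdAddChar
          (progressionInv p u k s₁ t₁ ↑b.1⁻¹)‖ - ‖unitKloosterman ZMod.stdAddChar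
          (progressionInv p u k s₂ t₂ ↑b.2⁻¹)‖)]
    _ ≤ (p : ℝ) ^ u * (4 * (p : ℝ) ^ (u + k)) := by
        rw [Finset.sum_const, nsmul_eq_mul]
        have h := card_linearPairs_le (l₁ : ZMod (p ^ u)) l₂ m hl
        rw [ZMod.card] at h
        gcongr
        exact_mod_cast h
    _ = _ := by ring

theorem charSum_eq_zero {p u k : ℕ} (hp : p.Prime) (hk : 0 < k) (hku : 2 * k ≤ u)
    (s₁ s₂ t₁ t₂ l₁ l₂ m : ℤ) (ht₁ : IsCoprime (p : ℤ) t₁) (ht₂ : IsCoprime (p : ℤ) t₂)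
    (hl₁ : IsCoprime (p : ℤ) l₁) (hm : (p : ℤ) ^ k ∣ m)
    (hne : ¬ ∃ r₁ r₂ : ℤ, r₁ ^ 2 ≡ t₁ [ZMOD (p : ℤ) ^ k] ∧ r₂ ^ 2 ≡ t₂ [ZMOD (p : ℤ) ^ k] ∧
      r₂ ^ 3 * s₁ * l₁ ≡ r₁ ^ 3 * s₂ * l₂ [ZMOD (p : ℤ) ^ k]) :
    charSum p (u + k) u s₁ s₂ t₁ t₂ l₁ l₂ m = 0 := by
  have : NeZero (p ^ u) := ⟨pow_ne_zero _ hp.ne_zero⟩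
  have : NeZero (p ^ (u + k)) := ⟨pow_ne_zero _ hp.ne_zero⟩
  rw [charSum_eq_sum_linearPairs]
  obtain ⟨d, rfl⟩ := Nat.exists_eq_add_of_le hku
  have hpow : ∀ e, 2 * k + d + k ≤ e → (p : ZMod (p ^ (2 * k + d + k))) ^ e = 0 := by
    intro e he
    refine pow_eq_zero_of_le he ?_
    have := ZMod.natCast_self (p ^ (2 * k + d + k))
    push_cast at this
    exact this
  have hzero : ∀ z : ℤ, (p : ZMod (p ^ (2 * k + d + k))) ^ (2 * k + d) * z = 0 ↔
      (p : ℤ) ^ k ∣ z := by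
    intro z
    have h := ZMod.intCast_zmod_eq_zero_iff_dvd ((p : ℤ) ^ (2 * k + d) * z) (p ^ (2 * k + d + k))
    push_cast at h
    rw [h, pow_add _ (2 * k + d) k, mul_dvd_mul_iff_left]
    exact pow_ne_zero _ (by exact_mod_cast hp.ne_zero)
  set P : ZMod (p ^ (2 * k + d + k)) := (p : ZMod (p ^ (2 * k + d + k))) ^ (2 * k + d) with hP
  have hPP : P * P = 0 := by
    rw [hP, ← pow_add]
    exact hpow _ (by omega)
  have hPπ : P * (p : ZMod (p ^ (2 * k + d + k))) ^ k = 0 := by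
    rw [hP, ← pow_add]
    exact hpow _ (by omega)
  have hn : ∀ s t : ℤ, IsCoprime (p : ℤ) t → ∀ a : ZMod (p ^ (2 * k + d)),
      progressionInv p (2 * k + d) k s t a * ((s : ZMod (p ^ (2 * k + d + k))) *
        (p : ZMod (p ^ (2 * k + d + k))) ^ k * (a.val : ZMod (p ^ (2 * k + d + k))) + t) = 1 :=
    fun s t ht a => ZMod.inv_mul_of_unit _ (isUnit_progression hk s t ht a)
  -- the stationary points do not depend on the summation variable
  have hstat : ∀ s t : ℤ, IsCoprime (p : ℤ) t → ∀ (a : ZMod (p ^ (2 * k + d)))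
      (x : (ZMod (p ^ (2 * k + d + k)))ˣ),
      P * ((x : ZMod (p ^ (2 * k + d + k))) - progressionInv p (2 * k + d) k s t a *
        (↑x⁻¹ : ZMod (p ^ (2 * k + d + k)))) = 0 ↔
      P * ((↑x⁻¹ : ZMod (p ^ (2 * k + d + k))) ^ 2 - t) = 0 := by
    intro s t ht a x
    have h := hn s t ht a
    have hx := x.mul_inv
    set n := progressionInv p (2 * k + d) k s t a
    set i : ZMod (p ^ (2 * k + d + k)) := ↑x⁻¹
    have hnt : P * (n * t) = P := by
      linear_combination P * h - n * s * (a.val : ZMod (p ^ (2 * k + d + k))) * hPπ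
    constructor
    · intro h0
      linear_combination (-i * t) * h0 - i ^ 2 * hnt + P * t * hx
    · intro h0
      linear_combination (-n * x) * h0 + P * n * i * hx - (x : ZMod (p ^ (2 * k + d + k))) * hnt
  have hKl : ∀ s t : ℤ, IsCoprime (p : ℤ) t → ∀ a : ZMod (p ^ (2 * k + d)),
      unitKloosterman ZMod.stdAddChar (progressionInv p (2 * k + d) k s t a) =
      ∑ x ∈ Finset.univ.filter (fun x : (ZMod (p ^ (2 * k + d + k)))ˣ =>
          P * ((↑x⁻¹ : ZMod (p ^ (2 * k + d + k))) ^ 2 - t) = 0),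
        ZMod.stdAddChar ((x : ZMod (p ^ (2 * k + d + k))) +
          progressionInv p (2 * k + d) k s t a * (↑x⁻¹ : ZMod (p ^ (2 * k + d + k)))) := by
    intro s t ht a
    rw [unitKloosterman_eq_sum_stationary _ ZMod.injective_stdAddChar _ P hPP]
    simp only [hstat s t ht a]
  have hcast : p ^ (2 * k + d) ∣ p ^ (2 * k + d + k) := pow_dvd_pow _ (by omega)
  set ρ := ZMod.castHom hcast (ZMod (p ^ (2 * k + d)))
  have hker : ∀ α β, ρ α = ρ β →
      (p : ZMod (p ^ (2 * k + d + k))) ^ k * α = (p : ZMod (p ^ (2 * k + d + k))) ^ k * β := by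
    intro α β h
    obtain ⟨α, rfl⟩ := ZMod.intCast_surjective α
    obtain ⟨β, rfl⟩ := ZMod.intCast_surjective β
    rw [map_intCast, map_intCast, ZMod.intCast_eq_intCast_iff_dvd_sub] at h
    push_cast at h
    obtain ⟨c, hc⟩ := h
    have hc' := congrArg (Int.cast : ℤ → ZMod (p ^ (2 * k + d + k))) hc
    push_cast at hc'
    linear_combination (-(p : ZMod (p ^ (2 * k + d + k))) ^ k) * hc' - c * hPπ
  calc _ = ∑ b ∈ linearPairs (l₁ : ZMod (p ^ (2 * k + d))) l₂ m,
        ∑ x ∈ Finset.univ.filter (fun x : (ZMod (p ^ (2 * k + d + k)))ˣ =>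
          P * ((↑x⁻¹ : ZMod (p ^ (2 * k + d + k))) ^ 2 - t₁) = 0),
        ∑ z ∈ Finset.univ.filter (fun z : (ZMod (p ^ (2 * k + d + k)))ˣ =>
          P * ((↑z⁻¹ : ZMod (p ^ (2 * k + d + k))) ^ 2 - t₂) = 0),
        (ZMod.stdAddChar ((x : ZMod (p ^ (2 * k + d + k))) - (z : ZMod (p ^ (2 * k + d + k)))) : ℂ) *
        ZMod.stdAddChar (progressionInv p (2 * k + d) k s₁ t₁ ↑b.1⁻¹ *
            (↑x⁻¹ : ZMod (p ^ (2 * k + d + k))) -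
          progressionInv p (2 * k + d) k s₂ t₂ ↑b.2⁻¹ *
            (↑z⁻¹ : ZMod (p ^ (2 * k + d + k)))) := by
        refine Finset.sum_congr rfl fun b _ => ?_
        rw [hKl s₁ t₁ ht₁, hKl s₂ t₂ ht₂, map_sum, Finset.sum_mul_sum]
        refine Finset.sum_congr rfl fun x _ => Finset.sum_congr rfl fun z _ => ?_
        rw [← AddChar.map_neg_eq_conj, ← AddChar.map_add_eq_mul, ← AddChar.map_add_eq_mul]
        congr 1
        ring
    _ = 0 := by
        rw [Finset.sum_comm]
        refine Finset.sum_eq_zero fun x hx => ?_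
        rw [Finset.sum_comm]
        refine Finset.sum_eq_zero fun z hz => ?_
        rw [← Finset.mul_sum]
        rw [Finset.mem_filter] at hx hz
        have := sum_linearPairs_eq_zero ρ
          (fun a => (a.val : ZMod (p ^ (2 * k + d + k)))) (fun a => by simp)
          ((p : ZMod (p ^ (2 * k + d + k))) ^ k) P ((p : ZMod (p ^ (2 * k + d + k))) ^ (k + d))
          hker (by rw [hP, ← pow_add]; ring) (by rw [hP, ← pow_add]; exact hpow _ (by omega))
          ?_ hPP hPπ s₁ s₂ t₁ t₂ l₁ l₂ m ↑x⁻¹ ↑z⁻¹ ((hzero m).2 hm) ?_ _ _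
          (hn s₁ t₁ ht₁) (hn s₂ t₂ ht₂) ZMod.stdAddChar ZMod.injective_stdAddChar hx.2 hz.2 ?_
        · rw [map_intCast, map_intCast, map_intCast] at this
          rw [this, mul_zero]
        · rw [map_pow, map_natCast, ← pow_add]
          refine pow_eq_zero_of_le (m := 2 * k + d) (by omega) ?_
          have := ZMod.natCast_self (p ^ (2 * k + d))
          push_cast at this
          exact this
        · rw [ZMod.coe_int_isUnit_iff_isCoprime]
          push_cast
          exact hl₁.pow_left
        · intro h0
          obtain ⟨r₁, hr₁⟩ := ZMod.intCast_surjective (↑x⁻¹ : ZMod (p ^ (2 * k + d + k)))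
          obtain ⟨r₂, hr₂⟩ := ZMod.intCast_surjective (↑z⁻¹ : ZMod (p ^ (2 * k + d + k)))
          have h1 := hx.2
          have h2 := hz.2
          rw [← hr₁] at h0 h1
          rw [← hr₂] at h0 h2
          refine hne ⟨r₁, r₂, ?_, ?_, ?_⟩
          · refine (Int.modEq_iff_dvd.2 ((hzero _).1 ?_)).symm
            push_cast
            exact h1
          · refine (Int.modEq_iff_dvd.2 ((hzero _).1 ?_)).symm
            push_cast
            exact h2
          · refine (Int.modEq_iff_dvd.2 ((hzero _).1 ?_)).symm
            push_cast
            linear_combination h0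

/-- in the range `u/2 ≥ γ − u`, `ν_p(m) ≥ γ − u`, the sum `𝔠_{γ,u}` vanishes
unless `t₁^{-3/2}s₁λ₁ ≡ t₂^{-3/2}s₂λ₂ (mod p^{γ−u})` for some choice of square roots
`r₁, r₂` of `t₁, t₂`, in which case `|𝔠_{γ,u}| ≪ p^{γ+u}·p^{ε(u)}` with an absolute
implied constant (`ε(u) = 0` or `1` according to the parity of `u`). -/
theorem stmt19 :
    ∃ Cst : ℝ, 0 < Cst ∧
      ∀ (p γ u : ℕ), p.Prime → p ≠ 2 → 2 ≤ γ → 1 ≤ u → 5 * u ≤ 4 * γ →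
      ∀ s₁ s₂ t₁ t₂ l₁ l₂ m : ℤ,
        Int.gcd (s₁ * s₂ * l₁ * l₂ * 2 * t₁ * t₂) p = 1 →
        2 * ((γ : ℤ) - u) ≤ u →
        (p : ℤ) ^ (γ - u) ∣ m →
        ((¬ (∃ r₁ r₂ : ℤ, r₁ ^ 2 ≡ t₁ [ZMOD (p : ℤ) ^ (γ - u)] ∧
              r₂ ^ 2 ≡ t₂ [ZMOD (p : ℤ) ^ (γ - u)] ∧
              r₂ ^ 3 * s₁ * l₁ ≡ r₁ ^ 3 * s₂ * l₂ [ZMOD (p : ℤ) ^ (γ - u)]) →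
            charSum p γ u s₁ s₂ t₁ t₂ l₁ l₂ m = 0) ∧
          ((∃ r₁ r₂ : ℤ, r₁ ^ 2 ≡ t₁ [ZMOD (p : ℤ) ^ (γ - u)] ∧
              r₂ ^ 2 ≡ t₂ [ZMOD (p : ℤ) ^ (γ - u)] ∧
              r₂ ^ 3 * s₁ * l₁ ≡ r₁ ^ 3 * s₂ * l₂ [ZMOD (p : ℤ) ^ (γ - u)]) →
            ‖charSum p γ u s₁ s₂ t₁ t₂ l₁ l₂ m‖ ≤
              Cst * (p : ℝ) ^ (γ + u) * (p : ℝ) ^ (if Even u then 0 else 1))) := by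
  refine ⟨4, by norm_num, ?_⟩
  intro p γ u hp hp2 hγ hu huγ s₁ s₂ t₁ t₂ l₁ l₂ m hgcd hku hm
  obtain ⟨k, rfl⟩ : ∃ k, γ = u + k := ⟨γ - u, by omega⟩
  rw [Nat.add_sub_cancel_left] at *
  have hk : 0 < k := by omega
  have hcop : IsCoprime (p : ℤ) (s₁ * s₂ * l₁ * l₂ * 2 * t₁ * t₂) :=
    (Int.isCoprime_iff_gcd_eq_one.2 hgcd).symm
  simp only [IsCoprime.mul_right_iff] at hcop
  obtain ⟨⟨⟨⟨⟨-, hl₁⟩, hl₂⟩, -⟩, ht₁⟩, ht₂⟩ := hcop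
  refine ⟨charSum_eq_zero hp hk (by omega) s₁ s₂ t₁ t₂ l₁ l₂ m ht₁ ht₂ hl₁ hm, fun _ => ?_⟩
  refine (norm_charSum_le hp hp2 hk hγ s₁ s₂ t₁ t₂ l₁ l₂ m ht₁ ht₂ hl₂).trans ?_
  have hp1 : (1 : ℝ) ≤ p := by exact_mod_cast hp.one_le
  exact le_mul_of_one_le_right (by positivity) (one_le_pow₀ hp1)
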